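/- arXiv:2103.16893 — 3 statements merged into one kernel-verified Lean document; each statement's English description precedes it below -/
import Mathlib

section
/- Fix an integer k ≥ 1 and any function t : ZMod k → {D, B}. On the finite set S = (ZMod k) × {(a,b) : a,b ∈ {1,2,3,4}, a ≠ b}, consider the equivalence relation generated by: (node relation) (i,(a,b)) ~ (i,(b,a)) for all i and all a ≠ b; (in-tile gluing) if t(i) = D then (i,(3,1)) ~ (i,(4,1)), (i,(3,2)) ~ (i,(4,2)), (i,(3,4)) ~ (i,(4,3)), and if t(i) = B then (i,(3,1)) ~ (i,(4,1)), (i,(3,2)) ~ (i,(4,3)), (i,(3,4)) ~ (i,(4,2)); (circle gluing) (i,(2,1)) ~ (i+1,(1,2)), (i,(2,3)) ~ (i+1,(1,3)), (i,(2,4)) ~ (i+1,(1,4)) for all i ∈ ZMod k. Then the number of equivalence classes is exactly k + 1 + |{i : t(i) = D}|. -/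
/-- The two tile types `D` and `B` of the paper. -/
inductive TileType where
  | D : TileType
  | B : TileType

/-- Ordered pairs `(a, b)` of distinct elements of the four-element label set
`{1, 2, 3, 4}` (realised inside `Fin 4`, where the four labels `1, 2, 3, 4` are
pairwise distinct); `(i, (a, b))` stands for the branch point on the line `Lₐ`
over the node `Lₐ ∩ L_b` in the `i`-th tile. -/
abbrev NodeBranch : Type := {p : Fin 4 × Fin 4 // p.1 ≠ p.2}

/-- Convenient constructor for elements of `NodeBranch`. -/
def pr (a b : Fin 4) (h : a ≠ b := by decide) : NodeBranch := ⟨(a, b), h⟩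

/-- The generating relation for `k` tiles, of types prescribed by `t`, glued in a circle:
the node relation, the in-tile gluing of `L₃` to `L₄` (of type `D` or `B`), and the
circle gluing of `L₂` of tile `i` to `L₁` of tile `i + 1`. -/
inductive CircleGen (k : ℕ) (t : ZMod k → TileType) :
    ZMod k × NodeBranch → ZMod k × NodeBranch → Prop
  | node (i : ZMod k) (a b : Fin 4) (h : a ≠ b) :
      CircleGen k t (i, ⟨(a, b), h⟩) (i, ⟨(b, a), h.symm⟩)
  | tileD₁ (i : ZMod k) (hi : t i = TileType.D) : CircleGen k t (i, pr 3 1) (i, pr 4 1)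
  | tileD₂ (i : ZMod k) (hi : t i = TileType.D) : CircleGen k t (i, pr 3 2) (i, pr 4 2)
  | tileD₃ (i : ZMod k) (hi : t i = TileType.D) : CircleGen k t (i, pr 3 4) (i, pr 4 3)
  | tileB₁ (i : ZMod k) (hi : t i = TileType.B) : CircleGen k t (i, pr 3 1) (i, pr 4 1)
  | tileB₂ (i : ZMod k) (hi : t i = TileType.B) : CircleGen k t (i, pr 3 2) (i, pr 4 3)
  | tileB₃ (i : ZMod k) (hi : t i = TileType.B) : CircleGen k t (i, pr 3 4) (i, pr 4 2)
  | circle₁ (i : ZMod k) : CircleGen k t (i, pr 2 1) (i + 1, pr 1 2)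
  | circle₂ (i : ZMod k) : CircleGen k t (i, pr 2 3) (i + 1, pr 1 3)
  | circle₃ (i : ZMod k) : CircleGen k t (i, pr 2 4) (i + 1, pr 1 4)

open Classical in
/-- The invariant classifying the equivalence classes. -/
noncomputable def cuspMap (k : ℕ) (t : ZMod k → TileType) (x : ZMod k × NodeBranch) :
    Option (ZMod k) ⊕ {i : ZMod k // t i = TileType.D} :=
  if x.2.1.1 = 1 ∨ x.2.1.2 = 1 then
    if x.2.1.1 = 2 ∨ x.2.1.2 = 2 then Sum.inl none else Sum.inl (some (x.1 - 1))
  else if x.2.1.1 = 2 ∨ x.2.1.2 = 2 then Sum.inl (some x.1)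
  else if h : t x.1 = TileType.D then Sum.inr ⟨x.1, h⟩ else Sum.inl (some x.1)

/-- A representative of each class. -/
def cuspRep (k : ℕ) (t : ZMod k → TileType) :
    Option (ZMod k) ⊕ {i : ZMod k // t i = TileType.D} → ZMod k × NodeBranch
  | Sum.inl none => (0, pr 1 2)
  | Sum.inl (some i) => (i, pr 2 3)
  | Sum.inr i => (i.1, pr 3 4)

theorem cuspMap_gen (k : ℕ) (t : ZMod k → TileType) (x y : ZMod k × NodeBranch)
    (h : CircleGen k t x y) : cuspMap k t x = cuspMap k t y := by
  cases h with
  | node i a b h => simp only [cuspMap, or_comm]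
  | _ => simp_all [cuspMap, pr]

theorem cuspMap_eqv (k : ℕ) (t : ZMod k → TileType) (x y : ZMod k × NodeBranch)
    (h : Relation.EqvGen (CircleGen k t) x y) : cuspMap k t x = cuspMap k t y := by
  induction h with
  | rel x y h => exact cuspMap_gen k t x y h
  | refl => rfl
  | symm _ _ _ ih => exact ih.symm
  | trans _ _ _ _ _ ih₁ ih₂ => exact ih₁.trans ih₂

theorem cuspMap_rep (k : ℕ) (t : ZMod k → TileType) (c) : cuspMap k t (cuspRep k t c) = c := by
  rcases c with (_ | i) | ⟨i, hi⟩
  · simp [cuspMap, cuspRep, pr]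
  · simp [cuspMap, cuspRep, pr]
  · simp [cuspMap, cuspRep, pr, hi]

theorem cusp_rep_eqv (k : ℕ) (hk : 1 ≤ k) (t : ZMod k → TileType) (x : ZMod k × NodeBranch) :
    Relation.EqvGen (CircleGen k t) (cuspRep k t (cuspMap k t x)) x := by
  have : NeZero k := ⟨by omega⟩
  let Q := Quotient (Relation.EqvGen.setoid (CircleGen k t))
  let q : ZMod k × NodeBranch → Q := Quotient.mk _
  have gen : ∀ {x y}, CircleGen k t x y → q x = q y :=
    fun h => Quotient.sound (Relation.EqvGen.rel _ _ h)
  suffices h : q (cuspRep k t (cuspMap k t x)) = q x from Quotient.exact h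
  have n (i : ZMod k) (a b : Fin 4) (h : a ≠ b) : q (i, pr a b h) = q (i, pr b a h.symm) :=
    gen (CircleGen.node i a b h)
  have h12 (m : ℕ) : q ((m : ZMod k), pr 1 2) = q (0, pr 1 2) := by
    induction m with
    | zero => simp
    | succ m ih =>
      rw [← ih, n _ 1 2, n _ 1 2, Nat.cast_succ, ← n _ 1 2]
      exact (gen (CircleGen.circle₁ _)).symm
  have h12' (i : ZMod k) : q (i, pr 1 2) = q (0, pr 1 2) := by
    have := h12 i.val
    rwa [ZMod.natCast_zmod_val] at this
  have h34 (i : ZMod k) (hi : t i ≠ TileType.D) : q (i, pr 3 4) = q (i, pr 2 3) := by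
    have hB : t i = TileType.B := by
      cases h : t i
      · exact absurd h hi
      · rfl
    rw [n i 3 4, n i 2 3]
    exact (gen (CircleGen.tileB₂ i hB)).symm
  have h24 (i : ZMod k) : q (i, pr 2 4) = q (i, pr 2 3) := by
    rw [n i 2 4, n i 2 3]
    cases h : t i
    · exact (gen (CircleGen.tileD₂ i h)).symm
    · rw [← gen (CircleGen.tileB₃ i h), n i 3 4]
      exact (gen (CircleGen.tileB₂ i h)).symm
  have h13 (i : ZMod k) : q (i, pr 1 3) = q (i - 1, pr 2 3) := by
    have := gen (CircleGen.circle₂ (t := t) (i - 1))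
    rw [sub_add_cancel] at this
    exact this.symm
  have h14 (i : ZMod k) : q (i, pr 1 4) = q (i - 1, pr 2 3) := by
    have := gen (CircleGen.circle₃ (t := t) (i - 1))
    rw [sub_add_cancel] at this
    rw [← h24]
    exact this.symm
  -- the ordered case, and then both orders
  have key (i : ZMod k) (a b : Fin 4) (h : a ≠ b)
      (hq : q (cuspRep k t (cuspMap k t (i, pr a b h))) = q (i, pr a b h)) :
      q (cuspRep k t (cuspMap k t (i, pr b a h.symm))) = q (i, pr b a h.symm) := by
    have hc : cuspMap k t (i, pr a b h) = cuspMap k t (i, pr b a h.symm) :=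
      cuspMap_gen k t _ _ (CircleGen.node i a b h)
    rw [← hc, ← n i a b h]
    exact hq
  have e12 (i : ZMod k) : q (cuspRep k t (cuspMap k t (i, pr 1 2))) = q (i, pr 1 2) := by
    rw [h12']; simp [cuspMap, cuspRep, pr]
  have e13 (i : ZMod k) : q (cuspRep k t (cuspMap k t (i, pr 1 3))) = q (i, pr 1 3) := by
    rw [h13]; simp [cuspMap, cuspRep, pr]
  have e14 (i : ZMod k) : q (cuspRep k t (cuspMap k t (i, pr 1 4))) = q (i, pr 1 4) := by
    rw [h14]; simp [cuspMap, cuspRep, pr]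
  have e23 (i : ZMod k) : q (cuspRep k t (cuspMap k t (i, pr 2 3))) = q (i, pr 2 3) := by
    simp [cuspMap, cuspRep, pr]
  have e24 (i : ZMod k) : q (cuspRep k t (cuspMap k t (i, pr 2 4))) = q (i, pr 2 4) := by
    rw [h24]; simp [cuspMap, cuspRep, pr]
  have e34 (i : ZMod k) : q (cuspRep k t (cuspMap k t (i, pr 3 4))) = q (i, pr 3 4) := by
    by_cases h : t i = TileType.D
    · simp [cuspMap, cuspRep, pr, h]
    · rw [h34 i h]; simp [cuspMap, cuspRep, pr, h]
  obtain ⟨i, ⟨⟨a, b⟩, h⟩⟩ := x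
  fin_cases a <;> fin_cases b <;>
    first
    | exact absurd rfl h
    | exact e12 i
    | exact e13 i
    | exact e14 i
    | exact e23 i
    | exact e24 i
    | exact e34 i
    | exact key i _ _ _ (e12 i)
    | exact key i _ _ _ (e13 i)
    | exact key i _ _ _ (e14 i)
    | exact key i _ _ _ (e23 i)
    | exact key i _ _ _ (e24 i)
    | exact key i _ _ _ (e34 i)

/-- For `k ≥ 1` tiles of types `t : ZMod k → {D, B}` glued in a circle, the equivalence
relation generated by the node, in-tile and circle gluing relations has exactly
`k + 1 + #{i | t i = D}` equivalence classes. -/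
theorem stmt1 (k : ℕ) (hk : 1 ≤ k) (t : ZMod k → TileType) :
    Nat.card (Quotient (Relation.EqvGen.setoid (CircleGen k t))) =
      k + 1 + Nat.card {i : ZMod k // t i = TileType.D} := by
  have : NeZero k := ⟨by omega⟩
  let e : Quotient (Relation.EqvGen.setoid (CircleGen k t)) ≃
      Option (ZMod k) ⊕ {i : ZMod k // t i = TileType.D} :=
    { toFun := Quotient.lift (cuspMap k t) (cuspMap_eqv k t)
      invFun := fun c => Quotient.mk _ (cuspRep k t c)
      left_inv := fun x => Quotient.inductionOn x
        (fun x => Quotient.sound (cusp_rep_eqv k hk t x))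
      right_inv := fun c => cuspMap_rep k t c }
  rw [Nat.card_congr e, Nat.card_sum, Finite.card_option, Nat.card_zmod]
end

section
/- Fix an integer k ≥ 1. On the finite set S = (Fin k) × {(a,b) : a,b ∈ {1,2,3,4}, a ≠ b}, consider the equivalence relation generated by: (node relation) (i,(a,b)) ~ (i,(b,a)) for all i and a ≠ b; (in-tile gluing of type D) (i,(3,1)) ~ (i,(4,1)), (i,(3,2)) ~ (i,(4,2)), (i,(3,4)) ~ (i,(4,3)) for all i; (row gluing) (i,(2,1)) ~ (i+1,(1,2)), (i,(2,3)) ~ (i+1,(1,3)), (i,(2,4)) ~ (i+1,(1,4)) for all 0 ≤ i ≤ k−2; and (pinching) (0,(1,3)) ~ (0,(1,4)) and (k−1,(2,3)) ~ (k−1,(2,4)). Then there are exactly 2k+2 equivalence classes; the two pinch-fixed elements (0,(1,2)) and (k−1,(2,1)) lie in one and the same class, namely {(i,(1,2)), (i,(2,1)) : i ∈ Fin k}; and the remaining 2k+1 classes contain neither (0,(1,2)) nor (k−1,(2,1)). -/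
/-- The generating relation for `k` tiles of type `D` glued in a row ("on a stick"):
the node relation, the in-tile gluing of `L₃` to `L₄` of type `D`, the row gluing of
`L₂` of tile `i` to `L₁` of tile `i + 1` for `0 ≤ i ≤ k − 2`, and the pinching of the
two outer lines, identifying `(0,(1,3))` with `(0,(1,4))` and `(k−1,(2,3))` with
`(k−1,(2,4))`. -/
inductive StickGen (k : ℕ) : Fin k × NodeBranch → Fin k × NodeBranch → Prop
  | node (i : Fin k) (a b : Fin 4) (h : a ≠ b) :
      StickGen k (i, ⟨(a, b), h⟩) (i, ⟨(b, a), h.symm⟩)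
  | tileD₁ (i : Fin k) : StickGen k (i, pr 3 1) (i, pr 4 1)
  | tileD₂ (i : Fin k) : StickGen k (i, pr 3 2) (i, pr 4 2)
  | tileD₃ (i : Fin k) : StickGen k (i, pr 3 4) (i, pr 4 3)
  | row₁ (i : ℕ) (h : i + 1 < k) :
      StickGen k (⟨i, Nat.lt_of_succ_lt h⟩, pr 2 1) (⟨i + 1, h⟩, pr 1 2)
  | row₂ (i : ℕ) (h : i + 1 < k) :
      StickGen k (⟨i, Nat.lt_of_succ_lt h⟩, pr 2 3) (⟨i + 1, h⟩, pr 1 3)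
  | row₃ (i : ℕ) (h : i + 1 < k) :
      StickGen k (⟨i, Nat.lt_of_succ_lt h⟩, pr 2 4) (⟨i + 1, h⟩, pr 1 4)
  | pinch₁ (h : 0 < k) : StickGen k (⟨0, h⟩, pr 1 3) (⟨0, h⟩, pr 1 4)
  | pinch₂ (h : 0 < k) :
      StickGen k (⟨k - 1, Nat.sub_lt h Nat.one_pos⟩, pr 2 3)
        (⟨k - 1, Nat.sub_lt h Nat.one_pos⟩, pr 2 4)

/-- The type of a branch point within its tile. -/
def nodeType (p : NodeBranch) : ℕ :=
  if p = pr 1 2 ∨ p = pr 2 1 then 0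
  else if p = pr 3 4 ∨ p = pr 4 3 then 1
  else if p.1.1 = 1 ∨ p.1.2 = 1 then 2 else 3

/-- The numerical invariant separating the classes. -/
def stickInv (k : ℕ) (x : Fin k × NodeBranch) : ℕ :=
  if nodeType x.2 = 0 then 0
  else if nodeType x.2 = 1 then 1 + x.1.1
  else if nodeType x.2 = 2 then k + 1 + x.1.1
  else k + 2 + x.1.1

theorem nodeType_swap : ∀ (a b : Fin 4) (h : a ≠ b),
    nodeType ⟨(a, b), h⟩ = nodeType ⟨(b, a), h.symm⟩ := by decide

theorem nodeType_zero : ∀ p : NodeBranch, nodeType p = 0 → p = pr 1 2 ∨ p = pr 2 1 := by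
  decide

theorem nodeBranch_cases : ∀ p : NodeBranch,
    ((p = pr 1 2 ∨ p = pr 2 1) ∧ nodeType p = 0) ∨
    ((p = pr 3 4 ∨ p = pr 4 3) ∧ nodeType p = 1) ∨
    ((p = pr 1 3 ∨ p = pr 3 1 ∨ p = pr 4 1 ∨ p = pr 1 4) ∧ nodeType p = 2) ∨
    ((p = pr 2 3 ∨ p = pr 3 2 ∨ p = pr 4 2 ∨ p = pr 2 4) ∧ nodeType p = 3) := by
  decide

theorem stickInv_gen {k : ℕ} {x y : Fin k × NodeBranch} (h : StickGen k x y) :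
    stickInv k x = stickInv k y := by
  have e1 : nodeType (pr 1 2) = 0 := by decide
  have e2 : nodeType (pr 2 1) = 0 := by decide
  have e3 : nodeType (pr 3 4) = 1 := by decide
  have e4 : nodeType (pr 4 3) = 1 := by decide
  have e5 : nodeType (pr 1 3) = 2 := by decide
  have e6 : nodeType (pr 3 1) = 2 := by decide
  have e7 : nodeType (pr 4 1) = 2 := by decide
  have e8 : nodeType (pr 1 4) = 2 := by decide
  have e9 : nodeType (pr 2 3) = 3 := by decide
  have e10 : nodeType (pr 3 2) = 3 := by decide
  have e11 : nodeType (pr 4 2) = 3 := by decide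
  have e12 : nodeType (pr 2 4) = 3 := by decide
  cases h with
  | node i a b h => simp only [stickInv, nodeType_swap a b h]
  | _ => simp only [stickInv, e1, e2, e3, e4, e5, e6, e7, e8, e9, e10, e11, e12] <;> norm_num <;> omega

theorem stickInv_eqv {k : ℕ} {x y : Fin k × NodeBranch}
    (h : Relation.EqvGen (StickGen k) x y) : stickInv k x = stickInv k y := by
  induction h with
  | rel _ _ h => exact stickInv_gen h
  | refl _ => rfl
  | symm _ _ _ ih => exact ih.symm
  | trans _ _ _ _ _ ih1 ih2 => exact ih1.trans ih2

theorem eqv_swap {k : ℕ} (i : Fin k) (a b : Fin 4) (h : a ≠ b) :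
    Relation.EqvGen (StickGen k) (i, pr a b h) (i, pr b a h.symm) :=
  .rel _ _ (.node i a b h)

theorem eqv_rep {k : ℕ} (i : Fin k) (p : NodeBranch) :
    (nodeType p = 0 ∧ Relation.EqvGen (StickGen k) (i, p) (i, pr 1 2)) ∨
    (nodeType p = 1 ∧ Relation.EqvGen (StickGen k) (i, p) (i, pr 3 4)) ∨
    (nodeType p = 2 ∧ Relation.EqvGen (StickGen k) (i, p) (i, pr 1 3)) ∨
    (nodeType p = 3 ∧ Relation.EqvGen (StickGen k) (i, p) (i, pr 2 3)) := by
  have h41 : Relation.EqvGen (StickGen k) (i, pr 4 1) (i, pr 1 3) :=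
    .trans _ _ _ (.symm _ _ (.rel _ _ (.tileD₁ i))) (eqv_swap i 3 1 _)
  have h42 : Relation.EqvGen (StickGen k) (i, pr 4 2) (i, pr 2 3) :=
    .trans _ _ _ (.symm _ _ (.rel _ _ (.tileD₂ i))) (eqv_swap i 3 2 _)
  rcases nodeBranch_cases p with ⟨h, e⟩ | ⟨h, e⟩ | ⟨h, e⟩ | ⟨h, e⟩
  · refine .inl ⟨e, ?_⟩
    rcases h with rfl | rfl
    · exact .refl _
    · exact eqv_swap i 2 1 _
  · refine .inr (.inl ⟨e, ?_⟩)
    rcases h with rfl | rfl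
    · exact .refl _
    · exact eqv_swap i 4 3 _
  · refine .inr (.inr (.inl ⟨e, ?_⟩))
    rcases h with rfl | rfl | rfl | rfl
    · exact .refl _
    · exact eqv_swap i 3 1 _
    · exact h41
    · exact .trans _ _ _ (eqv_swap i 1 4 _) h41
  · refine .inr (.inr (.inr ⟨e, ?_⟩))
    rcases h with rfl | rfl | rfl | rfl
    · exact .refl _
    · exact eqv_swap i 3 2 _
    · exact h42
    · exact .trans _ _ _ (eqv_swap i 2 4 _) h42

theorem eqv_zero {k : ℕ} (hk : 0 < k) (i : ℕ) (hi : i < k) :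
    Relation.EqvGen (StickGen k) (⟨i, hi⟩, pr 1 2) (⟨0, hk⟩, pr 1 2) := by
  induction i with
  | zero => exact .refl _
  | succ n ih =>
    exact .trans _ _ _ (.symm _ _ (.rel _ _ (.row₁ n hi)))
      (.trans _ _ _ (eqv_swap _ 2 1 _) (ih (by omega)))

theorem eqv_of_stickInv {k : ℕ} {x y : Fin k × NodeBranch} (h : stickInv k x = stickInv k y) :
    Relation.EqvGen (StickGen k) x y := by
  obtain ⟨⟨i, hi⟩, p⟩ := x
  obtain ⟨⟨j, hj⟩, q⟩ := y
  have hk : 0 < k := by omega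
  have hp := eqv_rep ⟨i, hi⟩ p
  have hq := eqv_rep ⟨j, hj⟩ q
  rcases hp with ⟨e, hp⟩ | ⟨e, hp⟩ | ⟨e, hp⟩ | ⟨e, hp⟩ <;>
  rcases hq with ⟨e', hq⟩ | ⟨e', hq⟩ | ⟨e', hq⟩ | ⟨e', hq⟩ <;>
  simp [stickInv, e, e'] at h <;>
  refine .trans _ _ _ hp (.trans _ _ _ ?_ (.symm _ _ hq)) <;>
  first
  | exact .trans _ _ _ (eqv_zero hk i hi) (.symm _ _ (eqv_zero hk j hj))
  | (exfalso; omega)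
  | (obtain rfl : i = j := by omega
     exact .refl _)
  | (obtain rfl : i = j + 1 := by omega
     exact .symm _ _ (.rel _ _ (.row₂ j hi)))
  | (obtain rfl : j = i + 1 := by omega
     exact .rel _ _ (.row₂ i hj))

theorem stickInv_lt {k : ℕ} (x : Fin k × NodeBranch) : stickInv k x < 2 * k + 2 := by
  have := x.1.2
  unfold stickInv
  split_ifs <;> omega

theorem stickInv_surj {k : ℕ} (hk : 0 < k) (n : ℕ) (hn : n < 2 * k + 2) :
    ∃ x, stickInv k x = n := by
  have e1 : nodeType (pr 1 2) = 0 := by decide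
  have e3 : nodeType (pr 3 4) = 1 := by decide
  have e5 : nodeType (pr 1 3) = 2 := by decide
  have e9 : nodeType (pr 2 3) = 3 := by decide
  by_cases h0 : n = 0
  · exact ⟨(⟨0, hk⟩, pr 1 2), by simp [stickInv, e1, h0]⟩
  by_cases h1 : n ≤ k
  · exact ⟨(⟨n - 1, by omega⟩, pr 3 4), by simp only [stickInv, e3]; norm_num; omega⟩
  by_cases h2 : n ≤ 2 * k
  · exact ⟨(⟨n - (k + 1), by omega⟩, pr 1 3), by simp [stickInv, e5]; omega⟩
  · exact ⟨(⟨k - 1, by omega⟩, pr 2 3), by simp [stickInv, e9]; omega⟩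

theorem stick_card {k : ℕ} (hk : 0 < k) :
    (Relation.EqvGen.setoid (StickGen k)).classes.ncard = 2 * k + 2 := by
  have e : Quotient (Relation.EqvGen.setoid (StickGen k)) ≃ Fin (2 * k + 2) :=
    Equiv.ofBijective
      (Quotient.lift (fun x => (⟨stickInv k x, stickInv_lt x⟩ : Fin (2 * k + 2)))
        (fun _ _ h => Fin.ext (stickInv_eqv h))) (by
        constructor
        · intro a b
          refine Quotient.inductionOn₂ a b fun x y h => ?_
          exact Quotient.sound (eqv_of_stickInv (congrArg Fin.val h))
        · rintro ⟨n, hn⟩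
          obtain ⟨x, hx⟩ := stickInv_surj hk n hn
          exact ⟨Quotient.mk _ x, Fin.ext hx⟩)
  rw [← Nat.card_coe_set_eq,
    ← Nat.card_congr (Setoid.quotientEquivClasses (Relation.EqvGen.setoid (StickGen k))),
    Nat.card_congr e, Nat.card_fin]

theorem stick_class {k : ℕ} (hk : 0 < k) (x : Fin k × NodeBranch) :
    Relation.EqvGen (StickGen k) x (⟨0, hk⟩, pr 1 2) ↔
      ∃ i : Fin k, x = (i, pr 1 2) ∨ x = (i, pr 2 1) := by
  have e1 : nodeType (pr 1 2) = 0 := by decide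
  have e2 : nodeType (pr 2 1) = 0 := by decide
  constructor
  · intro h
    have h := stickInv_eqv h
    have h0 : nodeType x.2 = 0 := by
      by_contra hne
      simp only [stickInv, e1, hne, if_true, if_false] at h
      split_ifs at h <;> omega
    refine ⟨x.1, (nodeType_zero _ h0).imp (fun h => ?_) (fun h => ?_)⟩ <;>
    exact Prod.ext rfl h
  · rintro ⟨i, rfl | rfl⟩ <;> exact eqv_of_stickInv (by simp [stickInv, e1, e2])

/-- For `k ≥ 1` tiles of type `D` glued in a row with the two outer lines pinched,
the generated equivalence relation has exactly `2k + 2` classes; the two pinch-fixed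
elements `(0,(1,2))` and `(k−1,(2,1))` lie in one and the same class, namely
`{(i,(1,2)), (i,(2,1)) : i ∈ Fin k}`, and the remaining `2k + 1` classes contain
neither of them. -/
theorem stmt3 (k : ℕ) (hk : 1 ≤ k) :
    (Relation.EqvGen.setoid (StickGen k)).classes.ncard = 2 * k + 2 ∧
    {x : Fin k × NodeBranch | Relation.EqvGen (StickGen k) x ((⟨0, hk⟩ : Fin k), pr 1 2)} =
      {x : Fin k × NodeBranch | ∃ i : Fin k, x = (i, pr 1 2) ∨ x = (i, pr 2 1)} ∧
    Relation.EqvGen (StickGen k) ((⟨0, hk⟩ : Fin k), pr 1 2)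
      ((⟨k - 1, Nat.sub_lt hk Nat.one_pos⟩ : Fin k), pr 2 1) ∧
    ∀ C ∈ (Relation.EqvGen.setoid (StickGen k)).classes,
      C ≠ {x : Fin k × NodeBranch | ∃ i : Fin k, x = (i, pr 1 2) ∨ x = (i, pr 2 1)} →
      ((⟨0, hk⟩ : Fin k), pr 1 2) ∉ C ∧
      ((⟨k - 1, Nat.sub_lt hk Nat.one_pos⟩ : Fin k), pr 2 1) ∉ C := by
  have h3 : Relation.EqvGen (StickGen k) ((⟨0, hk⟩ : Fin k), pr 1 2)
      ((⟨k - 1, Nat.sub_lt hk Nat.one_pos⟩ : Fin k), pr 2 1) :=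
    .symm _ _ ((stick_class hk _).2 ⟨_, .inr rfl⟩)
  refine ⟨stick_card hk, Set.ext fun x => stick_class hk x, h3, ?_⟩
  rintro C ⟨y, rfl⟩ hC
  have key : ¬ Relation.EqvGen (StickGen k) ((⟨0, hk⟩ : Fin k), pr 1 2) y := by
    intro h
    apply hC
    ext x
    rw [Set.mem_ofPred_eq, Set.mem_ofPred_eq, ← stick_class hk x]
    exact ⟨fun hx => .trans _ _ _ hx (.symm _ _ h), fun hx => .trans _ _ _ hx h⟩
  exact ⟨key, fun h => key (.trans _ _ _ h3 h)⟩
end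

section
/- Let S be a finite set and r₀ a symmetric relation on S. Let A, B ⊆ S be disjoint 3-element subsets, g : A → B a bijection, and φ : A → Fin 3 a bijection. Let ~ be the equivalence relation on S generated by r₀ together with the pairs a ~ g(a) for a ∈ A. Let S' = S ⊕ (Fin 2 × Fin 3) and let ~' be the equivalence relation on S' generated by r₀ (on the copy of S), the pairs a ~' (0, φ(a)) for a ∈ A, the pairs (0, n) ~' (1, n) for n ∈ Fin 3, and the pairs (1, φ(a)) ~' g(a) for a ∈ A. Then every ~'-equivalence class contains an element of S, and the map sending a ~'-class to its intersection with S is a bijection from the set of ~'-classes onto the set of ~-classes; in particular ~' has exactly as many equivalence classes as ~. -/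
/-- The gluing relation of the original surface: the symmetric relation `r₀` together
with the pairs `a ~ g a` for `a ∈ A`. -/
def baseRel {S : Type*} (r₀ : S → S → Prop) (A B : Set S) (g : A ≃ B) :
    S → S → Prop :=
  fun x y => r₀ x y ∨ ∃ a : A, x = (a : S) ∧ y = ((g a : B) : S)

/-- The gluing relation of the infected surface on `S ⊕ (Fin 2 × Fin 3)`: the relation
`r₀` on the copy of `S`, the pairs `a ~ (0, φ a)` for `a ∈ A`, the pairs
`(0, n) ~ (1, n)`, and the pairs `(1, φ a) ~ g a` for `a ∈ A`. -/
def infectedRel {S : Type*} (r₀ : S → S → Prop) (A B : Set S) (g : A ≃ B)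
    (φ : A ≃ Fin 3) : S ⊕ (Fin 2 × Fin 3) → S ⊕ (Fin 2 × Fin 3) → Prop :=
  fun x y =>
    (∃ u v : S, r₀ u v ∧ x = Sum.inl u ∧ y = Sum.inl v) ∨
    (∃ a : A, x = Sum.inl (a : S) ∧ y = Sum.inr (0, φ a)) ∨
    (∃ n : Fin 3, x = Sum.inr (0, n) ∧ y = Sum.inr (1, n)) ∨
    (∃ a : A, x = Sum.inr (1, φ a) ∧ y = Sum.inl ((g a : B) : S))

/-- Elementary infection does not change the set of equivalence classes: every class of
the infected relation meets (the copy of) `S`, intersecting with `S` is a bijection from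
the classes of the infected relation onto the classes of the original relation, and in
particular the two relations have the same number of classes. -/
theorem stmt5 (S : Type*) [Finite S] (r₀ : S → S → Prop) (hr₀ : Symmetric r₀)
    (A B : Set S) (hA : A.ncard = 3) (hB : B.ncard = 3) (hAB : Disjoint A B)
    (g : A ≃ B) (φ : A ≃ Fin 3) :
    (∀ C' ∈ (Relation.EqvGen.setoid (infectedRel r₀ A B g φ)).classes,
      ∃ x : S, Sum.inl x ∈ C') ∧
    Set.BijOn (fun C' : Set (S ⊕ (Fin 2 × Fin 3)) => Sum.inl ⁻¹' C')
      (Relation.EqvGen.setoid (infectedRel r₀ A B g φ)).classes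
      (Relation.EqvGen.setoid (baseRel r₀ A B g)).classes ∧
    (Relation.EqvGen.setoid (infectedRel r₀ A B g φ)).classes.ncard =
      (Relation.EqvGen.setoid (baseRel r₀ A B g)).classes.ncard := by
  classical
  let p : S ⊕ (Fin 2 × Fin 3) → S := Sum.elim id (fun q => (φ.symm q.2 : S))
  have down : ∀ x y, Relation.EqvGen (infectedRel r₀ A B g φ) x y →
      Relation.EqvGen (baseRel r₀ A B g) (p x) (p y) := by
    intro x y h
    induction h with
    | rel x y h =>
      rcases h with ⟨u, v, h, rfl, rfl⟩ | ⟨a, rfl, rfl⟩ | ⟨n, rfl, rfl⟩ | ⟨a, rfl, rfl⟩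
      · exact .rel _ _ (Or.inl h)
      · simpa [p] using Relation.EqvGen.refl (r := baseRel r₀ A B g) (a : S)
      · exact .refl _
      · have : Relation.EqvGen (baseRel r₀ A B g) (a : S) (g a : S) :=
          .rel _ _ (Or.inr ⟨a, rfl, rfl⟩)
        simpa [p] using this
    | refl x => exact .refl _
    | symm x y _ ih => exact .symm _ _ ih
    | trans x y z _ _ ih1 ih2 => exact .trans _ _ _ ih1 ih2
  have toZero : ∀ a : A, Relation.EqvGen (infectedRel r₀ A B g φ)
      (Sum.inl (a : S)) (Sum.inr (0, φ a)) :=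
    fun a => .rel _ _ (Or.inr (Or.inl ⟨a, rfl, rfl⟩))
  have toOne : ∀ a : A, Relation.EqvGen (infectedRel r₀ A B g φ)
      (Sum.inl (a : S)) (Sum.inr (1, φ a)) :=
    fun a => .trans _ _ _ (toZero a) (.rel _ _ (Or.inr (Or.inr (Or.inl ⟨φ a, rfl, rfl⟩))))
  have up : ∀ x y, Relation.EqvGen (baseRel r₀ A B g) x y →
      Relation.EqvGen (infectedRel r₀ A B g φ) (Sum.inl x) (Sum.inl y) := by
    intro x y h
    induction h with
    | rel x y h =>
      rcases h with h | ⟨a, rfl, rfl⟩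
      · exact .rel _ _ (Or.inl ⟨x, y, h, rfl, rfl⟩)
      · exact .trans _ _ _ (toOne a) (.rel _ _ (Or.inr (Or.inr (Or.inr ⟨a, rfl, rfl⟩))))
    | refl x => exact .refl _
    | symm x y _ ih => exact .symm _ _ ih
    | trans x y z _ _ ih1 ih2 => exact .trans _ _ _ ih1 ih2
  have retr : ∀ x, Relation.EqvGen (infectedRel r₀ A B g φ) (Sum.inl (p x)) x := by
    rintro (x | ⟨i, n⟩)
    · exact .refl _
    · obtain ⟨a, rfl⟩ := φ.surjective n
      fin_cases i
      · simpa [p] using toZero a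
      · simpa [p] using toOne a
  have meets : ∀ C' ∈ (Relation.EqvGen.setoid (infectedRel r₀ A B g φ)).classes,
      ∃ x : S, Sum.inl x ∈ C' := by
    rintro _ ⟨y, rfl⟩
    exact ⟨p y, retr y⟩
  have bij : Set.BijOn (fun C' : Set (S ⊕ (Fin 2 × Fin 3)) => Sum.inl ⁻¹' C')
      (Relation.EqvGen.setoid (infectedRel r₀ A B g φ)).classes
      (Relation.EqvGen.setoid (baseRel r₀ A B g)).classes := by
    refine ⟨?_, ?_, ?_⟩
    · rintro _ ⟨y, rfl⟩
      refine ⟨p y, ?_⟩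
      ext x
      constructor
      · intro h
        exact down _ _ h
      · intro h
        exact .trans _ _ _ (up _ _ h) (retr y)
    · intro C hC D hD h
      obtain ⟨x, hx⟩ := meets C hC
      have hx' : Sum.inl x ∈ D := by
        have : x ∈ Sum.inl ⁻¹' C := hx
        have h' : Sum.inl ⁻¹' C = Sum.inl ⁻¹' D := h
        rw [h'] at this
        exact this
      exact Setoid.eq_of_mem_classes hC hx hD hx'
    · rintro _ ⟨y, rfl⟩
      refine ⟨_, ⟨Sum.inl y, rfl⟩, ?_⟩
      ext x
      exact ⟨fun h => down _ _ h, fun h => up _ _ h⟩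
  exact ⟨meets, bij, bij.injOn.ncard_image ▸ by rw [bij.image_eq]⟩
end
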